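/- Let S : ℝ → ℝ be defined by S(x) = (1/(p−1))·Q(x) + (1/2)·x·Q'(x). Then LS = −Q; that is, for every x ∈ ℝ one has −S''(x) + S(x) − p·Q(x)^(p−1)·S(x) = −Q(x). -/

import Mathlib

/-- The soliton profile `Q(x) = ((p+1)/(2 cosh²(((p−1)/2)x)))^(1/(p−1))`. -/
noncomputable def Q (p : ℕ) (x : ℝ) : ℝ :=
  (((p : ℝ) + 1) / (2 * Real.cosh ((((p : ℝ) - 1) / 2) * x) ^ 2)) ^ (1 / ((p : ℝ) - 1))

/-- The scaling direction `S(x) = (1/(p−1)) Q(x) + (1/2) x Q'(x)`. -/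
noncomputable def S (p : ℕ) (x : ℝ) : ℝ :=
  (1 / ((p : ℝ) - 1)) * Q p x + (1 / 2) * x * deriv (Q p) x

theorem hasDerivAt_tanh_mul (c x : ℝ) :
    HasDerivAt (fun y => Real.tanh (c * y)) (c * (1 - Real.tanh (c * x) ^ 2)) x := by
  have hc : Real.cosh (c * x) ≠ 0 := (Real.cosh_pos _).ne'
  have hlin : HasDerivAt (fun y : ℝ => c * y) c x := by
    simpa using (hasDerivAt_id x).const_mul c
  have h := hlin.sinh.div hlin.cosh hc
  have hfun : (fun y => Real.tanh (c * y)) =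
      (fun y => Real.sinh (c * y)) / (fun y => Real.cosh (c * y)) := by
    funext y
    simp [Real.tanh_eq_sinh_div_cosh]
  rw [hfun]
  refine h.congr_deriv ?_
  rw [Real.tanh_eq_sinh_div_cosh]
  field_simp

theorem hasDerivAt_Q {p : ℕ} (hp : 2 ≤ p) (x : ℝ) :
    HasDerivAt (Q p) (-(Real.tanh (((p : ℝ) - 1) / 2 * x) * Q p x)) x := by
  have hp' : (2 : ℝ) ≤ p := by exact_mod_cast hp
  have hm : (p : ℝ) - 1 ≠ 0 := by linarith
  have hp1 : (p : ℝ) + 1 ≠ 0 := by linarith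
  have hc : 0 < Real.cosh (((p : ℝ) - 1) / 2 * x) := Real.cosh_pos _
  have hlin : HasDerivAt (fun y : ℝ => ((p : ℝ) - 1) / 2 * y) (((p : ℝ) - 1) / 2) x := by
    simpa using (hasDerivAt_id x).const_mul (((p : ℝ) - 1) / 2)
  have hbase := (hasDerivAt_const x ((p : ℝ) + 1)).div ((hlin.cosh.pow 2).const_mul 2)
    (by simpa using hc.ne')
  have hpos : 0 < ((p : ℝ) + 1) / (2 * Real.cosh (((p : ℝ) - 1) / 2 * x) ^ 2) := by positivity
  have h := hbase.rpow_const (p := 1 / ((p : ℝ) - 1)) (Or.inl hpos.ne')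
  refine h.congr_deriv ?_
  simp only [Pi.div_apply, Pi.pow_apply]
  rw [Real.rpow_sub_one hpos.ne', Real.tanh_eq_sinh_div_cosh]
  change _ * (Q p x / _) = _
  field_simp
  ring

theorem Q_pow_sub_one {p : ℕ} (hp : 2 ≤ p) (x : ℝ) :
    Q p x ^ (p - 1) = ((p : ℝ) + 1) / 2 * (1 - Real.tanh (((p : ℝ) - 1) / 2 * x) ^ 2) := by
  have hc : 0 < Real.cosh (((p : ℝ) - 1) / 2 * x) := Real.cosh_pos _
  have hcast : (p : ℝ) - 1 = ((p - 1 : ℕ) : ℝ) := by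
    rw [Nat.cast_sub (by omega), Nat.cast_one]
  have hpow : Q p x ^ (p - 1) =
      ((p : ℝ) + 1) / (2 * Real.cosh (((p : ℝ) - 1) / 2 * x) ^ 2) := by
    unfold Q
    rw [one_div, show ((p : ℝ) - 1)⁻¹ = (((p - 1 : ℕ) : ℝ))⁻¹ by rw [hcast]]
    exact Real.rpow_inv_natCast_pow (by positivity) (by omega)
  rw [hpow, Real.tanh_eq_sinh_div_cosh]
  field_simp
  rw [Real.cosh_sq]
  ring

theorem S_eq {p : ℕ} (hp : 2 ≤ p) :
    S p = fun x => Q p x * (1 / ((p : ℝ) - 1) - 1 / 2 * (x * Real.tanh (((p : ℝ) - 1) / 2 * x))) := by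
  funext x
  rw [S, (hasDerivAt_Q hp x).deriv]
  ring

/-- `LS = −Q`, i.e. `−S'' + S − pQ^(p−1)S = −Q` pointwise. -/
theorem stmt8 (p : ℕ) (hp : 2 ≤ p) (x : ℝ) :
    -(deriv (deriv (S p)) x) + S p x - (p : ℝ) * Q p x ^ (p - 1) * S p x = -Q p x := by
  have hp' : (2 : ℝ) ≤ p := by exact_mod_cast hp
  have hm : (p : ℝ) - 1 ≠ 0 := by linarith
  have hQ := hasDerivAt_Q hp
  have hT := hasDerivAt_tanh_mul (((p : ℝ) - 1) / 2)
  have hxT := fun y : ℝ => (hasDerivAt_id' y).mul (hT y)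
  have hS := fun y : ℝ => (hQ y).mul (((hxT y).const_mul (1 / 2)).const_sub (1 / ((p : ℝ) - 1)))
  have hS' : deriv (S p) = fun y => -(Real.tanh (((p : ℝ) - 1) / 2 * y) * S p y) +
      Q p y * -(1 / 2 * (Real.tanh (((p : ℝ) - 1) / 2 * y) +
        y * (((p : ℝ) - 1) / 2 * (1 - Real.tanh (((p : ℝ) - 1) / 2 * y) ^ 2)))) := by
    rw [S_eq hp]
    funext y
    refine ((hS y).congr_deriv ?_).deriv
    simp only [Pi.mul_apply]
    ring
  have hSd : HasDerivAt (S p) (deriv (S p) x) x := by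
    have h : DifferentiableAt ℝ (S p) x := by
      rw [S_eq hp]
      exact (hS x).differentiableAt
    exact h.hasDerivAt
  have hS'' := ((hT x).mul hSd).neg.add ((hQ x).mul ((((hT x).add ((hasDerivAt_id' x).mul
    ((((hT x).pow 2).const_sub 1).const_mul (((p : ℝ) - 1) / 2)))).const_mul (1 / 2)).neg))
  have hd := (hS''.congr_of_eventuallyEq (f₁ := deriv (S p))
    (Filter.Eventually.of_forall fun y => congrFun hS' y)).deriv
  rw [hd, hS', Q_pow_sub_one hp, S_eq hp]
  simp only [Pi.mul_apply, Pi.add_apply, Pi.neg_apply, Pi.pow_apply, Nat.cast_ofNat]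
  field_simp
  ring
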